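/- arXiv:2305.05284 — 4 statements merged into one kernel-verified Lean document; each statement's English description precedes it below -/
import Mathlib

section
/- Let z ∈ Ω = {0,1}^N be a binary sequence containing at least one 0 and at least one 1, with first bit F = z_1, bit counts N_0, N_1, and transition counts N_{ij}. Then the number of sequences z' ∈ Ω with the same first bit (z'_1 = z_1) and the same transition counts (N_{ij}(z') = N_{ij}(z) for all i,j ∈ {0,1}) equals N_{F,1−F} · (N_0 − 1)! (N_1 − 1)! / (N_{00}! N_{01}! N_{10}! N_{11}!). If z consists entirely of 0s or entirely of 1s, this number equals 1. -/
open Finset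

/-- Number of 1s in a binary sequence. -/
def onesCount {N : ℕ} (z : Fin N → Bool) : ℕ :=
  (Finset.univ.filter fun n => z n = true).card

/-- Number of 0s in a binary sequence. -/
def zerosCount {N : ℕ} (z : Fin N → Bool) : ℕ := N - onesCount z

/-- `transCount z i j` is the number of indices `n ∈ {0,…,N−2}` with
`(z_n, z_{n+1}) = (i, j)`. -/
def transCount {N : ℕ} (z : Fin N → Bool) (i j : Bool) : ℕ :=
  (Finset.univ.filter fun n : Fin (N - 1) =>
    z ⟨n.1, by have := n.2; omega⟩ = i ∧ z ⟨n.1 + 1, by have := n.2; omega⟩ = j).card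

/-- The set of sequences with the same Markov type as `z`
(same first bit and same transition counts). -/
def sameMarkovType {N : ℕ} (hN : 0 < N) (z : Fin N → Bool) :
    Finset (Fin N → Bool) :=
  Finset.univ.filter fun z' =>
    z' ⟨0, hN⟩ = z ⟨0, hN⟩ ∧ ∀ i j, transCount z' i j = transCount z i j


lemma tc_cons {n : ℕ} (x : Bool) (w : Fin (n+1) → Bool) (i j : Bool) :
    transCount (Fin.cons x w : Fin (n+2) → Bool) i j
      = (if x = i ∧ w 0 = j then 1 else 0) + transCount w i j := by
  unfold transCount
  rw [Finset.card_filter, Finset.card_filter]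
  exact Fin.sum_univ_succ (n := n) _

lemma oc_cons {n : ℕ} (x : Bool) (w : Fin (n+1) → Bool) :
    onesCount (Fin.cons x w : Fin (n+2) → Bool)
      = (if x = true then 1 else 0) + onesCount w := by
  unfold onesCount
  rw [Finset.card_filter, Finset.card_filter]
  exact Fin.sum_univ_succ (n := n+1) _

lemma tc_one (w : Fin 1 → Bool) (i j : Bool) : transCount w i j = 0 := by
  unfold transCount
  rw [Finset.card_filter]
  exact Fin.sum_univ_zero _

/-- sequences with first bit F and prescribed transition counts -/
def MT (n : ℕ) (F : Bool) (a o b d : ℕ) : Finset (Fin (n+1) → Bool) :=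
  Finset.univ.filter fun w => w 0 = F ∧ transCount w F F = a ∧ transCount w F (!F) = o ∧
    transCount w (!F) F = b ∧ transCount w (!F) (!F) = d

/-- first tail part -/
def MA (n : ℕ) (F : Bool) (a o b d : ℕ) : Finset (Fin (n+1) → Bool) :=
  Finset.univ.filter fun w => w 0 = F ∧ transCount w F F + 1 = a ∧ transCount w F (!F) = o ∧
    transCount w (!F) F = b ∧ transCount w (!F) (!F) = d

/-- second tail part -/
def MB (n : ℕ) (F : Bool) (a o b d : ℕ) : Finset (Fin (n+1) → Bool) :=
  Finset.univ.filter fun w => w 0 = (!F) ∧ transCount w F F = a ∧ transCount w F (!F) + 1 = o ∧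
    transCount w (!F) F = b ∧ transCount w (!F) (!F) = d

lemma MT_succ (n : ℕ) (F : Bool) (a o b d : ℕ) :
    (MT (n+1) F a o b d).card = (MA n F a o b d).card + (MB n F a o b d).card := by
  have hd : Disjoint (MA n F a o b d) (MB n F a o b d) := by
    rw [Finset.disjoint_left]
    intro w h1 h2
    simp only [MA, MB, Finset.mem_filter] at h1 h2
    have := h1.2.1.symm.trans h2.2.1
    cases F <;> simp at this
  rw [← Finset.card_union_of_disjoint hd]
  have : MT (n+1) F a o b d = (MA n F a o b d ∪ MB n F a o b d).image
      (fun w => (Fin.cons F w : Fin (n+2) → Bool)) := by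
    ext w
    obtain ⟨x, v, rfl⟩ : ∃ (x : Bool) (v : Fin (n+1) → Bool), w = (Fin.cons x v : Fin (n+2) → Bool) :=
      ⟨w 0, Fin.tail w, (Fin.cons_self_tail w).symm⟩
    simp only [Finset.mem_image, Fin.cons_inj, MT, MA, MB, Finset.mem_union, Finset.mem_filter,
      Finset.mem_univ, true_and, tc_cons, Fin.cons_zero]
    constructor
    · rintro ⟨rfl, h⟩
      refine ⟨v, ?_, rfl, rfl⟩
      cases x <;> cases hv : v 0 <;> simp [hv] at h ⊢ <;> omega
    · rintro ⟨w, h, rfl, rfl⟩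
      refine ⟨rfl, ?_⟩
      cases F <;> cases hv : w 0 <;> simp [hv] at h ⊢ <;> omega
  rw [this, Finset.card_image_of_injective]
  intro u v h
  exact (Fin.cons_inj.1 h).2

lemma MA_zero (n : ℕ) (F : Bool) (o b d : ℕ) : (MA n F 0 o b d).card = 0 := by
  simp [MA]
lemma MB_zero (n : ℕ) (F : Bool) (a b d : ℕ) : (MB n F a 0 b d).card = 0 := by
  simp [MB]
lemma MA_succ (n : ℕ) (F : Bool) (a o b d : ℕ) : MA n F (a+1) o b d = MT n F a o b d := by
  simp [MA, MT]
lemma MB_succ (n : ℕ) (F : Bool) (a o b d : ℕ) : MB n F a (o+1) b d = MT n (!F) d b o a := by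
  ext w
  simp only [MB, MT, Finset.mem_filter, Bool.not_not, Nat.add_right_cancel_iff]
  tauto

lemma MT_card (n : ℕ) : ∀ (F : Bool) (a o b d : ℕ), a + o + b + d = n → (o = b ∨ o = b + 1) →
    (MT n F a o b d).card = Nat.multichoose (b+1) a * Nat.multichoose o d := by
  induction n with
  | zero =>
    intro F a o b d h _
    obtain ⟨rfl, rfl, rfl, rfl⟩ : a = 0 ∧ o = 0 ∧ b = 0 ∧ d = 0 := by omega
    simp only [MT, tc_one]
    have : (Finset.univ.filter fun w : Fin (0+1) → Bool =>
        w 0 = F ∧ 0 = 0 ∧ 0 = 0 ∧ 0 = 0 ∧ 0 = 0) = {fun _ => F} := by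
      ext w
      simp only [Finset.mem_filter, Finset.mem_univ, true_and, and_true, Finset.mem_singleton]
      constructor
      · intro hw
        funext k
        obtain rfl : k = 0 := Fin.eq_zero k
        exact hw
      · rintro rfl
        rfl
    simpa using congrArg Finset.card this
  | succ n ih =>
    intro F a o b d h hv
    rw [MT_succ]
    rcases a with _ | a <;> rcases o with _ | o
    · obtain rfl : b = 0 := by omega
      rw [MA_zero, MB_zero]
      obtain rfl : d = n + 1 := by omega
      simp
    · rw [MA_zero, MB_succ, ih _ _ _ _ _ (by omega) (by omega)]
      simp
    · rw [MB_zero, MA_succ, ih _ _ _ _ _ (by omega) (by omega)]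
      obtain rfl : b = 0 := by omega
      simp
    · rw [MA_succ, MB_succ, ih _ _ _ _ _ (by omega) (by omega), ih _ _ _ _ _ (by omega) (by omega),
        Nat.multichoose_succ_succ b a]
      ring

lemma facts (n : ℕ) : ∀ (w : Fin (n+1) → Bool),
    let F := w 0
    transCount w F F + transCount w F (!F) + transCount w (!F) F + transCount w (!F) (!F) = n ∧
    (transCount w F (!F) = transCount w (!F) F ∨ transCount w F (!F) = transCount w (!F) F + 1) ∧
    onesCount w = transCount w false true + transCount w true true + (if F = true then 1 else 0) ∧
    ((∃ k, w k = !F) → 0 < transCount w F (!F)) ∧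
    ((∀ k, w k = F) → transCount w F (!F) = 0 ∧ transCount w (!F) (!F) = 0) := by
  induction n with
  | zero =>
    intro w
    simp only [tc_one]
    refine ⟨trivial, Or.inl trivial, ?_, ?_, fun _ => ⟨trivial, trivial⟩⟩
    · unfold onesCount
      rw [Finset.card_filter]
      exact (Fin.sum_univ_one _).trans (by omega)
    · rintro ⟨k, hk⟩
      obtain rfl : k = 0 := Fin.eq_zero k
      simp at hk
  | succ n ih =>
    intro w
    obtain ⟨x, v, rfl⟩ : ∃ (x : Bool) (v : Fin (n+1) → Bool), w = (Fin.cons x v : Fin (n+2) → Bool) :=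
      ⟨w 0, Fin.tail w, (Fin.cons_self_tail w).symm⟩
    have := ih v
    obtain ⟨h1, h2, h3, h4, h5⟩ := this
    simp only [Fin.cons_zero, tc_cons, oc_cons, Fin.forall_fin_succ (n := n+1),
      Fin.cons_succ, Fin.exists_fin_succ (n := n+1)]
    refine ⟨?_, ?_, ?_, ?_, ?_⟩
    · cases x <;> cases hv : v 0 <;> simp [hv] at * <;> omega
    · cases x <;> cases hv : v 0 <;> simp [hv] at * <;> omega
    · cases x <;> cases hv : v 0 <;> simp [hv] at * <;> omega
    · rintro (h | h)
      · simp at h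
      · by_cases hv : v 0 = x
        · rw [hv] at h4
          have := h4 h
          omega
        · have : v 0 = !x := by cases x <;> cases hv' : v 0 <;> simp_all
          simp [this]
    · rintro ⟨_, h⟩
      have h0 := h 0
      rw [h0] at h5
      have := h5 h
      simp [h0, this]

lemma final_arith (a o b d : ℕ) (ho : 0 < o) :
    ((Nat.multichoose (b+1) a * Nat.multichoose o d : ℕ) : ℝ) =
      o * (a + b).factorial * (o + d - 1).factorial /
        (a.factorial * o.factorial * b.factorial * d.factorial) := by
  obtain ⟨p, rfl⟩ : ∃ p, o = p + 1 := ⟨o - 1, by omega⟩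
  rw [Nat.multichoose_eq, Nat.multichoose_eq]
  have e1 : b + 1 + a - 1 = a + b := by omega
  have e2 : p + 1 + d - 1 = d + p := by omega
  rw [e1, e2]
  rw [Nat.choose_symm_add, Nat.choose_symm_add]
  have h1 := Nat.add_choose_mul_factorial_mul_factorial a b
  have h2 := Nat.add_choose_mul_factorial_mul_factorial d p
  rw [← h1, ← h2, Nat.factorial_succ p]
  have := Nat.factorial_ne_zero a
  have := Nat.factorial_ne_zero b
  have := Nat.factorial_ne_zero p
  have := Nat.factorial_ne_zero d
  rw [eq_div_iff (by positivity)]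
  push_cast
  ring

lemma same_eq (n : ℕ) (z : Fin (n+1) → Bool) (h : 0 < n + 1) :
    sameMarkovType h z = MT n (z 0) (transCount z (z 0) (z 0)) (transCount z (z 0) (!z 0))
      (transCount z (!z 0) (z 0)) (transCount z (!z 0) (!z 0)) := by
  ext w
  simp only [sameMarkovType, MT, Finset.mem_filter, Finset.mem_univ, true_and, Bool.forall_bool]
  have e : (⟨0, h⟩ : Fin (n+1)) = 0 := rfl
  rw [e]
  cases z 0 <;> simp only [Bool.not_true, Bool.not_false] <;> tauto

theorem card_sameMarkovType (N : ℕ) (hN : 1 < N) (z : Fin N → Bool) :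
    ((∃ n, z n = true) → (∃ n, z n = false) →
      ((sameMarkovType (by omega) z).card : ℝ) =
        (transCount z (z ⟨0, by omega⟩) (!z ⟨0, by omega⟩) : ℝ) *
          (Nat.factorial (zerosCount z - 1)) * (Nat.factorial (onesCount z - 1)) /
          ((Nat.factorial (transCount z false false)) *
            (Nat.factorial (transCount z false true)) *
            (Nat.factorial (transCount z true false)) *
            (Nat.factorial (transCount z true true)))) ∧
    (((∀ n, z n = false) ∨ (∀ n, z n = true)) →
      (sameMarkovType (by omega) z).card = 1) := by
  obtain ⟨n, rfl⟩ : ∃ n, N = n + 1 := ⟨N - 1, by omega⟩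
  obtain ⟨h1, h2, h3, h4, h5⟩ := facts n z
  rw [same_eq, MT_card _ _ _ _ _ _ h1 h2]
  have e : ∀ h, (⟨0, h⟩ : Fin (n+1)) = 0 := fun _ => rfl
  simp only [e]
  constructor
  · intro ht hf
    have hex : ∃ k, z k = !z 0 := by
      cases z 0
      · exact ht
      · exact hf
    have ho := h4 hex
    rw [final_arith _ _ _ _ ho]
    unfold zerosCount
    cases hz : z 0
    · simp only [hz, Bool.not_false, Bool.not_true, Bool.false_eq_true, if_false] at *
      have e1 : n + 1 - onesCount z - 1 = transCount z false false + transCount z true false := by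
        omega
      rw [e1, h3]
      simp
    · simp only [hz, Bool.not_false, Bool.not_true, if_true] at *
      have e1 : n + 1 - onesCount z - 1 = transCount z true false + transCount z false false - 1 := by
        omega
      have e2 : onesCount z - 1 = transCount z true true + transCount z false true := by
        omega
      rw [e1, e2]
      congr 1 <;> ring
  · intro h
    have hc : ∀ k, z k = z 0 := by
      rcases h with h | h <;> intro k <;> rw [h, h]
    obtain ⟨p, q⟩ := h5 hc
    have hb : transCount z (!z 0) (z 0) = 0 := by omega
    rw [p, q, hb]
    simp
end

section
/- The lower benchmark LB is an e-variable with respect to every IID Bernoulli measure: for every θ ∈ [0,1], ∑_{z ∈ Ω} θ^{N_1(z)} (1−θ)^{N_0(z)} · LB(z) ≤ 1. -/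
open Finset

/-- The lower benchmark (with the convention `0 ^ 0 = 1`, which holds
for `Real` powers with natural exponents). -/
noncomputable def LB {N : ℕ} (z : Fin N → Bool) : ℝ :=
  (1 / 2) * ((Nat.factorial (transCount z false false)) *
      (Nat.factorial (transCount z false true)) *
      (Nat.factorial (transCount z true false)) *
      (Nat.factorial (transCount z true true))) /
    ((Nat.factorial (transCount z false false + transCount z false true + 1)) *
      (Nat.factorial (transCount z true false + transCount z true true + 1)) *
      ((zerosCount z : ℝ) / N) ^ zerosCount z *
      ((onesCount z : ℝ) / N) ^ onesCount z)

lemma aux_pow (t : ℝ) (ht : 0 ≤ t) (n k : ℕ) (hn : 0 < n) :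
    t ^ k ≤ ((k : ℝ) / n) ^ k * Real.exp (n * t - k) := by
  have hn' : (0 : ℝ) < n := by exact_mod_cast hn
  rcases Nat.eq_zero_or_pos k with rfl | hk
  · simp
    positivity
  · have hk' : (0 : ℝ) < k := by exact_mod_cast hk
    have e : t = (k : ℝ) / n * (n * t / k) := by field_simp
    have h1 : n * t / k ≤ Real.exp (n * t / k - 1) := by
      have := Real.add_one_le_exp (n * t / k - 1)
      linarith
    have h2 : (n * t / k) ^ k ≤ Real.exp (n * t / k - 1) ^ k :=
      pow_le_pow_left₀ (by positivity) h1 k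
    rw [← Real.exp_nat_mul] at h2
    have e2 : (k : ℝ) * (n * t / k - 1) = n * t - k := by field_simp
    rw [e2] at h2
    calc t ^ k = ((k : ℝ) / n) ^ k * (n * t / k) ^ k := by
          rw [← mul_pow, ← e]
      _ ≤ _ := mul_le_mul_of_nonneg_left h2 (by positivity)

lemma aux_ml (t : ℝ) (h0 : 0 ≤ t) (h1 : t ≤ 1) (n k l : ℕ) (hn : 0 < n) (h : k + l = n) :
    t ^ k * (1 - t) ^ l ≤ ((l : ℝ) / n) ^ l * ((k : ℝ) / n) ^ k := by
  have a := aux_pow t h0 n k hn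
  have b := aux_pow (1 - t) (by linarith) n l hn
  have c := mul_le_mul a b (pow_nonneg (by linarith) _) (by positivity)
  refine c.trans (le_of_eq ?_)
  have hh : (k : ℝ) + l = n := by exact_mod_cast h
  have : Real.exp (n * t - k) * Real.exp (n * (1 - t) - l) = 1 := by
    rw [← Real.exp_add, Real.exp_eq_one_iff]
    linarith
  linear_combination ((k : ℝ) / n) ^ k * ((l : ℝ) / n) ^ l * this

/-- Laplace weight from counts. -/
noncomputable def auxQ (a b c d : ℕ) : ℝ :=
  ((Nat.factorial a : ℝ) * Nat.factorial b * Nat.factorial c * Nat.factorial d) /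
    ((Nat.factorial (a + b + 1) : ℝ) * Nat.factorial (c + d + 1))

noncomputable def auxW {N : ℕ} (z : Fin N → Bool) : ℝ :=
  auxQ (transCount z false false) (transCount z false true)
    (transCount z true false) (transCount z true true)

lemma auxQ_zero (a b c d : ℕ) : auxQ (a + 1) b c d + auxQ a (b + 1) c d = auxQ a b c d := by
  unfold auxQ
  rw [show a + 1 + b + 1 = (a + b + 1) + 1 by ring, show a + (b + 1) + 1 = (a + b + 1) + 1 by ring]
  simp only [Nat.factorial_succ (a + b + 1), Nat.factorial_succ a, Nat.factorial_succ b]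
  have := Nat.factorial_pos (a + b + 1)
  have := Nat.factorial_pos (c + d + 1)
  push_cast
  field_simp
  ring

lemma auxQ_one (a b c d : ℕ) : auxQ a b (c + 1) d + auxQ a b c (d + 1) = auxQ a b c d := by
  have h : ∀ a b c d, auxQ a b c d = auxQ c d a b := by
    intro a b c d
    unfold auxQ
    congr 1 <;> ring
  rw [h, h a b c (d + 1), auxQ_zero, h]

lemma trans_snoc {m : ℕ} (z : Fin (m + 1) → Bool) (x i j : Bool) :
    transCount (Fin.snoc (α := fun _ => Bool) z x : Fin (m + 2) → Bool) i j =
      transCount z i j + if z (Fin.last m) = i ∧ x = j then 1 else 0 := by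
  unfold transCount
  simp only [Finset.card_filter]
  change (∑ n : Fin (m + 1), _) = (∑ n : Fin m, _) + _
  rw [Fin.sum_univ_castSucc]
  congr 1
  · refine Finset.sum_congr rfl fun n _ => ?_
    have h1 : n.1 < m + 1 := by omega
    simp [Fin.snoc, h1]
  · simp [Fin.snoc, Fin.last]

lemma auxW_sum (m : ℕ) : ∑ z : Fin (m + 1) → Bool, auxW z = 2 := by
  induction m with
  | zero =>
    have : ∀ z : Fin 1 → Bool, auxW z = 1 := by
      intro z
      simp [auxW, auxQ, transCount]
    simp [this]
  | succ m ih =>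
    rw [← ih, ← (Fin.snocEquiv (fun _ : Fin (m + 2) => Bool)).sum_comp, Fintype.sum_prod_type_right]
    refine Finset.sum_congr rfl fun z _ => ?_
    change ∑ x : Bool, auxW (Fin.snoc (α := fun _ => Bool) z x : Fin (m + 2) → Bool) = _
    rw [Fintype.sum_bool]
    unfold auxW
    simp only [trans_snoc]
    cases h : z (Fin.last m)
    · simp
      rw [add_comm]
      exact auxQ_zero _ _ _ _
    · simp
      rw [add_comm]
      exact auxQ_one _ _ _ _

theorem LB_is_iid_evariable (N : ℕ) (hN : 1 < N) :
    ∀ θ ∈ Set.Icc (0:ℝ) 1,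
      ∑ z : Fin N → Bool,
        θ ^ onesCount z * (1 - θ) ^ zerosCount z * LB z ≤ 1 := by
  rintro θ ⟨h0, h1⟩
  have key : ∀ z : Fin N → Bool,
      θ ^ onesCount z * (1 - θ) ^ zerosCount z * LB z ≤ (1 / 2) * auxW z := by
    intro z
    have hle : onesCount z ≤ N := by
      unfold onesCount
      exact (Finset.card_le_univ _).trans (by simp)
    have hN0 : 0 < N := by omega
    have hNr : (0 : ℝ) < N := by exact_mod_cast hN0
    have ml := aux_ml θ h0 h1 N (onesCount z) (zerosCount z) hN0 (by unfold zerosCount; omega)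
    have pos : ∀ k : ℕ, (0 : ℝ) < ((k : ℝ) / N) ^ k := by
      intro k
      rcases Nat.eq_zero_or_pos k with rfl | hk
      · simp
      · positivity
    have hA := pos (zerosCount z)
    have hB := pos (onesCount z)
    have hW : 0 ≤ auxW z := by unfold auxW auxQ; positivity
    have e : LB z = (1 / 2) * auxW z / (((zerosCount z : ℝ) / N) ^ zerosCount z *
        ((onesCount z : ℝ) / N) ^ onesCount z) := by
      unfold LB auxW auxQ
      rw [← mul_div_assoc, div_div, mul_assoc (_ * _) (_ ^ _) (_ ^ _)]
    rw [e, ← mul_div_assoc, div_le_iff₀ (mul_pos hA hB), mul_comm]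
    exact mul_le_mul_of_nonneg_left ml (by positivity)
  refine (Finset.sum_le_sum fun z _ => key z).trans ?_
  obtain ⟨m, rfl⟩ : ∃ m, N = m + 1 := ⟨N - 1, by omega⟩
  rw [← Finset.mul_sum, auxW_sum]
  norm_num
end

section
/- The double integral ∫_0^1 ∫_0^1 [ (1−p) q ln(1−p) + p q ln p + p q ln q + p (1−q) ln(1−q) ] / (p + q) dp dq equals (2/3) ln 2 + (2/3) (ln 2)^2 − π²/9 − 1/6. -/
open Real
open MeasureTheory Set

lemma mk_series (j : ℕ) : ∫ x in (0:ℝ)..1, -Real.log (1 - x^(j+1)) / x = π^2/6/(j+1) := by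
  have hterm : ∀ n : ℕ, ∫ x in Ioc (0:ℝ) 1, x^((j+1)*n+j)/((n:ℝ)+1) = 1/((n:ℝ)+1)^2/(j+1) := by
    intro n
    rw [← intervalIntegral.integral_of_le zero_le_one, intervalIntegral.integral_div, integral_pow]
    push_cast
    have : ((j:ℝ)+1)*n+j+1 = (j+1)*(n+1) := by ring
    rw [this]
    simp
    field_simp
  have hz : HasSum (fun n : ℕ => 1/((n:ℝ)+1)^2/(j+1)) (π^2/6/(j+1)) := by
    apply HasSum.div_const
    have := (hasSum_nat_add_iff' (f := fun n : ℕ => 1/(n:ℝ)^2) 1).2 hasSum_zeta_two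
    simpa using this
  have hint : ∀ n : ℕ, Integrable (fun x : ℝ => x^((j+1)*n+j)/((n:ℝ)+1)) (volume.restrict (Ioc (0:ℝ) 1)) := by
    intro n
    have : Continuous (fun x : ℝ => x^((j+1)*n+j)/((n:ℝ)+1)) := by fun_prop
    exact (this.intervalIntegrable 0 1).1
  have hs := hasSum_integral_of_summable_integral_norm hint (by
    have : ∀ n : ℕ, ∫ x in Ioc (0:ℝ) 1, ‖x^((j+1)*n+j)/((n:ℝ)+1)‖ = 1/((n:ℝ)+1)^2/(j+1) := by
      intro n
      rw [← hterm n]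
      apply setIntegral_congr_fun measurableSet_Ioc
      intro x hx
      have := hx.1.le
      simp only [norm_eq_abs]
      apply abs_of_nonneg
      positivity
    simp_rw [this]
    exact hz.summable)
  simp_rw [hterm] at hs
  rw [← hs.unique hz, intervalIntegral.integral_of_le zero_le_one, integral_Ioc_eq_integral_Ioo, integral_Ioc_eq_integral_Ioo]
  apply setIntegral_congr_fun measurableSet_Ioo
  intro x hx
  have hx0 := hx.1
  have h1 : |x^(j+1)| < 1 := by
    rw [abs_of_pos (by positivity)]
    exact pow_lt_one₀ hx.1.le hx.2 (by omega)
  have h2 := (Real.hasSum_pow_div_log_of_abs_lt_one h1).div_const x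
  simp only
  rw [← h2.tsum_eq]
  apply tsum_congr
  intro n
  field_simp
  ring

lemma mk_int1 : IntervalIntegrable (fun x : ℝ => Real.log (1-x)) volume 0 1 := by
  have := (intervalIntegral.intervalIntegrable_log' (a := 1) (b := 0)).comp_sub_left 1
  simpa using this

lemma mk_int2 : IntervalIntegrable (fun x : ℝ => Real.log (1-x)/x) volume 0 1 := by
  have h2 : IntervalIntegrable (fun x : ℝ => (1-x) * Real.log (1-x)/x) volume 0 1 := by
    rw [intervalIntegrable_iff_integrableOn_Ioo_of_le zero_le_one]
    apply Measure.integrableOn_of_bounded (M := 1) (by simp)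
    · exact (by fun_prop : Measurable (fun x : ℝ => (1-x) * Real.log (1-x)/x)).aestronglyMeasurable
    · filter_upwards [ae_restrict_mem measurableSet_Ioo] with x hx
      have h0 := hx.1
      have h1 : 0 < 1 - x := by linarith [hx.2]
      have h3 := Real.one_sub_inv_le_log_of_pos h1
      have h4 : Real.log (1-x) ≤ 0 := Real.log_nonpos h1.le (by linarith)
      have h5 : -x ≤ (1-x)*Real.log (1-x) := by
        have := mul_le_mul_of_nonneg_left h3 h1.le
        have e : (1-x)*(1-(1-x)⁻¹) = -x := by field_simp; ring
        linarith
      rw [norm_eq_abs, abs_div, abs_of_pos h0, div_le_one h0, abs_le]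
      constructor
      · exact h5
      · nlinarith
  have := h2.add mk_int1
  rw [intervalIntegrable_iff_integrableOn_Ioo_of_le zero_le_one] at this ⊢
  refine this.congr_fun ?_ measurableSet_Ioo
  intro x hx
  have := hx.1.ne'
  simp only
  field_simp
  ring

lemma mk_L1 : ∫ x in (0:ℝ)..1, Real.log (1-x)/x = -π^2/6 := by
  have := mk_series 0
  simp only [zero_add, pow_one, neg_div, intervalIntegral.integral_neg] at this
  push_cast at this
  linarith

/-- dslope of log(1 + s x) -/
lemma mk_cont0 (s : ℝ) : ContinuousAt (fun x : ℝ => Real.log x * Real.log (1 + s * x)) 0 := by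
  have hd : DifferentiableAt ℝ (fun x : ℝ => Real.log (1 + s*x)) 0 := by
    apply DifferentiableAt.log
    · fun_prop
    · simp
  have h1 := (continuousAt_dslope_same.2 hd)
  have h2 := (Real.continuous_mul_log.continuousAt (x := 0)).mul h1
  refine h2.congr (Filter.Eventually.of_forall ?_)
  intro x
  by_cases hx : x = 0
  · simp [hx]
  · have : dslope (fun x : ℝ => Real.log (1 + s*x)) 0 x = Real.log (1+s*x)/x := by
      rw [dslope_of_ne _ hx, slope_def_field]
      simp
    rw [Pi.mul_apply, this]
    field_simp

lemma mk_L2int' : IntervalIntegrable (fun x : ℝ => Real.log (1+x)/x) volume 0 1 := by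
  rw [intervalIntegrable_iff_integrableOn_Ioo_of_le zero_le_one]
  apply Measure.integrableOn_of_bounded (M := 1) (by simp)
  · exact (by fun_prop : Measurable (fun x : ℝ => Real.log (1+x)/x)).aestronglyMeasurable
  · filter_upwards [ae_restrict_mem measurableSet_Ioo] with x hx
    have h0 := hx.1
    have h3 := Real.log_le_sub_one_of_pos (by linarith : 0 < 1 + x)
    have h4 : 0 ≤ Real.log (1+x) := Real.log_nonneg (by linarith)
    rw [norm_eq_abs, abs_div, abs_of_pos h0, div_le_one h0, abs_of_nonneg h4]
    linarith

lemma mk_L2' : ∫ x in (0:ℝ)..1, Real.log (1+x)/x = π^2/12 := by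
  have h := mk_series 1
  have e : ∫ x in (0:ℝ)..1, -Real.log (1 - x^(1+1)) / x
     = ∫ x in (0:ℝ)..1, (-(Real.log (1-x)/x) - Real.log (1+x)/x) := by
    simp only [intervalIntegral.integral_of_le zero_le_one, integral_Ioc_eq_integral_Ioo]
    apply setIntegral_congr_fun measurableSet_Ioo
    intro x hx
    have h1 : 1 - x ≠ 0 := by linarith [hx.2]
    have h2 : 1 + x ≠ 0 := by linarith [hx.1]
    have : 1 - x^(1+1) = (1-x)*(1+x) := by ring
    simp only [this, Real.log_mul h1 h2]
    ring
  rw [e, intervalIntegral.integral_sub (f := fun x : ℝ => -(Real.log (1-x)/x)) mk_int2.neg mk_L2int', intervalIntegral.integral_neg, mk_L1] at h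
  push_cast at h
  linarith

lemma mk_int3 (f : ℝ → ℝ) (hf : IntervalIntegrable f volume 0 1) :
    IntervalIntegrable (fun x : ℝ => f x/(1+x)) volume 0 1 := by
  simp only [div_eq_mul_inv]
  apply hf.mul_continuousOn
  apply ContinuousOn.inv₀ (by fun_prop)
  intro x hx
  rw [uIcc_of_le zero_le_one] at hx
  linarith [hx.1]

lemma mk_L2int : IntervalIntegrable (fun x : ℝ => Real.log x/(1+x)) volume 0 1 :=
  mk_int3 _ intervalIntegral.intervalIntegrable_log'

lemma mk_L3int : IntervalIntegrable (fun x : ℝ => Real.log (1-x)/(1+x)) volume 0 1 :=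
  mk_int3 _ mk_int1

lemma mk_L2 : ∫ x in (0:ℝ)..1, Real.log x/(1+x) = -π^2/12 := by
  have h := intervalIntegral.integral_eq_sub_of_hasDerivAt_of_le (a := 0) (b := 1)
    (f := fun x : ℝ => Real.log x * Real.log (1 + 1 * x))
    (f' := fun x => Real.log (1+x)/x + Real.log x/(1+x)) zero_le_one ?_ ?_ ?_
  · rw [intervalIntegral.integral_add mk_L2int' mk_L2int, mk_L2'] at h
    simp at h
    linarith
  · intro x hx
    apply ContinuousAt.continuousWithinAt
    rcases eq_or_lt_of_le hx.1 with h | h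
    · rw [← h]; exact mk_cont0 1
    · have : 1 + 1 * x ≠ 0 := by linarith
      exact (Real.continuousAt_log h.ne').mul (ContinuousAt.log (by fun_prop) this)
  · intro x hx
    have h1 : (1:ℝ) + 1 * x ≠ 0 := by linarith [hx.1]
    have h1' : (1:ℝ) + x ≠ 0 := by linarith [hx.1]
    have h0 : x ≠ 0 := hx.1.ne'
    have := (Real.hasDerivAt_log h0).mul ((((hasDerivAt_id x).const_mul 1).const_add 1).log h1)
    refine this.congr_deriv ?_
    simp
    field_simp
  · exact mk_L2int'.add mk_L2int

lemma mk_L0 : ∫ x in (0:ℝ)..1, Real.log (1+x)/(1+x) = (Real.log 2)^2/2 := by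
  have h := intervalIntegral.integral_eq_sub_of_hasDerivAt (a := 0) (b := 1)
    (f := fun x : ℝ => (Real.log (1 + x))^2/2)
    (f' := fun x => Real.log (1+x)/(1+x)) ?_ ?_
  · rw [h]; norm_num
  · intro x hx
    rw [uIcc_of_le zero_le_one] at hx
    have h1' : (1:ℝ) + x ≠ 0 := by linarith [hx.1]
    have := ((((hasDerivAt_id x).const_add 1).log h1').pow 2).div_const 2
    refine this.congr_deriv ?_
    simp
    field_simp
  · apply mk_int3
    apply ContinuousOn.intervalIntegrable
    apply ContinuousOn.log (by fun_prop)
    intro x hx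
    rw [uIcc_of_le zero_le_one] at hx
    linarith [hx.1]

lemma mk_L3 : ∫ x in (0:ℝ)..1, Real.log (1-x)/(1+x) = (Real.log 2)^2/2 - π^2/12 := by
  have him : (fun t : ℝ => (1-t)/(1+t)) '' Ioo 0 1 = Ioo 0 1 := by
    ext y
    constructor
    · rintro ⟨t, ht, rfl⟩
      have h1 : 0 < 1 + t := by linarith [ht.1]
      have h2 : 0 < 1 - t := by linarith [ht.2]
      exact ⟨by positivity, by rw [div_lt_one h1]; linarith [ht.1]⟩
    · intro hy
      have h1 : 0 < 1 + y := by linarith [hy.1]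
      have h2 : 0 < 1 - y := by linarith [hy.2]
      refine ⟨(1-y)/(1+y), ⟨by positivity, by rw [div_lt_one h1]; linarith [hy.1]⟩, ?_⟩
      have : 1 + (1-y)/(1+y) = 2/(1+y) := by field_simp; ring
      simp only [this]
      field_simp
      ring
  have hcv := integral_image_eq_integral_abs_deriv_smul (s := Ioo (0:ℝ) 1)
    (f := fun t : ℝ => (1-t)/(1+t)) (f' := fun t => -2/(1+t)^2) measurableSet_Ioo
    (by
      intro t ht
      have h1 : 1 + t ≠ 0 := by linarith [ht.1]
      have := ((hasDerivAt_id t).const_sub 1).div ((hasDerivAt_id t).const_add 1) h1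
      apply HasDerivAt.hasDerivWithinAt
      refine this.congr_deriv ?_
      simp
      ring)
    (by
      intro a ha b hb hab
      have h1 : 1 + a ≠ 0 := by linarith [ha.1]
      have h2 : 1 + b ≠ 0 := by linarith [hb.1]
      simp only at hab
      rw [div_eq_div_iff h1 h2] at hab
      linarith)
    (fun x => Real.log (1-x)/(1+x))
  rw [him] at hcv
  have e : ∫ t in Ioo (0:ℝ) 1, |(-2/(1+t)^2)| • (Real.log (1-(1-t)/(1+t))/(1+(1-t)/(1+t)))
     = ∫ t in (0:ℝ)..1, (Real.log 2 * (1/(1+t)) + Real.log t/(1+t) - Real.log (1+t)/(1+t)) := by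
    simp only [intervalIntegral.integral_of_le zero_le_one, integral_Ioc_eq_integral_Ioo]
    apply setIntegral_congr_fun measurableSet_Ioo
    intro t ht
    have h1 : 0 < 1 + t := by linarith [ht.1]
    have h0 := ht.1
    have e1 : 1 + (1-t)/(1+t) = 2/(1+t) := by field_simp; ring
    have e2 : 1 - (1-t)/(1+t) = 2*t/(1+t) := by field_simp; ring
    simp only [e1, e2]
    rw [Real.log_div (by positivity) h1.ne', Real.log_mul (by norm_num) h0.ne', neg_div, abs_neg,
      abs_of_pos (by positivity), smul_eq_mul]
    field_simp
  rw [intervalIntegral.integral_of_le zero_le_one, integral_Ioc_eq_integral_Ioo, hcv, e]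
  have i1 : IntervalIntegrable (fun t : ℝ => 1/(1+t)) volume 0 1 := mk_int3 (fun _ => 1) (by simp)
  have i0 : IntervalIntegrable (fun x : ℝ => Real.log (1+x)/(1+x)) volume 0 1 := by
    apply mk_int3
    apply ContinuousOn.intervalIntegrable
    apply ContinuousOn.log (by fun_prop)
    intro x hx
    rw [uIcc_of_le zero_le_one] at hx
    linarith [hx.1]
  have e3 : ∫ t in (0:ℝ)..1, 1/(1+t) = Real.log 2 := by
    have := intervalIntegral.integral_comp_add_left (fun x : ℝ => 1/x) 1 (a := 0) (b := 1)
    rw [this, integral_one_div]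
    · norm_num
    · rw [uIcc_of_le (by norm_num)]
      intro h
      linarith [h.1]
  rw [intervalIntegral.integral_sub ((i1.const_mul _).add mk_L2int) i0,
    intervalIntegral.integral_add (i1.const_mul _) mk_L2int, mk_L2, mk_L0,
    intervalIntegral.integral_const_mul, e3]
  ring

lemma mk_J : ∫ p in (0:ℝ)..1, (p * Real.log p + (1-p) * Real.log (1-p)) *
      (1 - p * (Real.log (1+p) - Real.log p))
    = (1 / 3) * Real.log 2 + (1 / 3) * (Real.log 2) ^ 2 - π ^ 2 / 18 - 1 / 12 := by
  have hl : ∀ x ∈ Icc (0:ℝ) 1, ContinuousAt (fun x : ℝ => Real.log (1+x)) x := by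
    intro x hx
    exact ContinuousAt.log (by fun_prop) (by linarith [hx.1])
  have hb : Continuous (fun x : ℝ => (1-x) * Real.log (1-x)) :=
    Real.continuous_mul_log.comp (continuous_const.sub continuous_id)
  have ha : Continuous (fun x : ℝ => x * Real.log x) := Real.continuous_mul_log
  have hcw : ContinuousOn (fun p : ℝ => (p * Real.log p + (1-p) * Real.log (1-p)) *
      (1 - p * (Real.log (1+p) - Real.log p))) (Icc 0 1) := by
    intro x hx
    apply ContinuousAt.continuousWithinAt
    have := (ha.continuousAt (x := x).add hb.continuousAt).mul
      ((continuousAt_const (y := (1:ℝ))).sub (((continuousAt_id (x := x)).mul (hl x hx)).sub ha.continuousAt))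
    refine this.congr (Filter.Eventually.of_forall ?_)
    intro y
    simp
    left
    ring
  have hiw : IntervalIntegrable (fun p : ℝ => (p * Real.log p + (1-p) * Real.log (1-p)) *
      (1 - p * (Real.log (1+p) - Real.log p))) volume 0 1 :=
    ContinuousOn.intervalIntegrable (by rwa [uIcc_of_le zero_le_one])
  have hi : IntervalIntegrable (fun p : ℝ => -(2/3) * (Real.log (1-p)/(1+p)) +
      1/3 * (Real.log p/(1+p)) + -(1/6) * (Real.log (1-p)/p)) volume 0 1 :=
    ((mk_L3int.const_mul _).add (mk_L2int.const_mul _)).add (mk_int2.const_mul _)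
  have hv : ∫ p in (0:ℝ)..1, (-(2/3) * (Real.log (1-p)/(1+p)) +
      1/3 * (Real.log p/(1+p)) + -(1/6) * (Real.log (1-p)/p))
      = -(2/3)*((Real.log 2)^2/2 - π^2/12) + 1/3*(-π^2/12) + -(1/6) * (-π^2/6) := by
    rw [intervalIntegral.integral_add ((mk_L3int.const_mul _).add (mk_L2int.const_mul _)) (mk_int2.const_mul _),
      intervalIntegral.integral_add (mk_L3int.const_mul _) (mk_L2int.const_mul _)]
    simp only [intervalIntegral.integral_const_mul, mk_L1, mk_L2, mk_L3]
  have h := intervalIntegral.integral_eq_sub_of_hasDerivAt_of_le (a := 0) (b := 1)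
    (f := fun p : ℝ => (p^2/2 * Real.log p - p^2/4 - (1-p)^2/2 * Real.log (1-p) + (1-p)^2/4)
      - ((-(1-p)^2*(1+2*p)/6) * Real.log (1-p) * Real.log (1+p)
        + p^3/3 * Real.log p * Real.log (1+p)
        - (-(1-p)^2*(1+2*p)/6) * (Real.log p * Real.log (1-p))
        - p^3/3 * (Real.log p)^2
        + (p^2/4 * Real.log p - p^2/8 - (p * Real.log p - p)/6)
        + (-((1-p)*(4-p))/6 * Real.log (1-p) - (4*p - p^2/2)/6)
        - ((1+p)^2/2 * Real.log (1+p) - (1+p)^2/4)/6))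
    (f' := fun p => (p * Real.log p + (1-p) * Real.log (1-p)) *
      (1 - p * (Real.log (1+p) - Real.log p)) + (-(2/3) * (Real.log (1-p)/(1+p)) +
      1/3 * (Real.log p/(1+p)) + -(1/6) * (Real.log (1-p)/p))) zero_le_one ?_ ?_ ?_
  · rw [intervalIntegral.integral_add hiw hi, hv] at h
    norm_num at h
    linarith
  · have hG : ContinuousOn (fun p : ℝ => (1-p)^2 * (Real.log p * Real.log (1-p))) (Icc 0 1) := by
      intro x hx
      apply ContinuousAt.continuousWithinAt
      rcases eq_or_lt_of_le hx.1 with h | h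
      · rw [← h]
        have := mk_cont0 (-1)
        have := (by fun_prop : ContinuousAt (fun p : ℝ => (1-p)^2) 0).mul this
        refine this.congr (Filter.Eventually.of_forall ?_)
        intro y
        simp [sub_eq_add_neg]
      · have := ((by fun_prop : ContinuousAt (fun p : ℝ => (1-p)) x).mul (Real.continuousAt_log h.ne')).mul hb.continuousAt
        refine this.congr (Filter.Eventually.of_forall ?_)
        intro y
        simp
        ring
    have hl' : ContinuousOn (fun x : ℝ => Real.log (1+x)) (Icc 0 1) := fun x hx => (hl x hx).continuousWithinAt
    have ha' := ha.continuousOn (s := Icc 0 1)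
    have hb' := hb.continuousOn (s := Icc 0 1)
    have : ContinuousOn (fun p : ℝ => (p/2 * (p * Real.log p) - p^2/4 - (1-p)/2 * ((1-p) * Real.log (1-p)) + (1-p)^2/4)
      - ((-(1-p)*(1+2*p)/6) * ((1-p) * Real.log (1-p)) * Real.log (1+p)
        + p^2/3 * (p * Real.log p) * Real.log (1+p)
        - (-(1+2*p)/6) * ((1-p)^2 * (Real.log p * Real.log (1-p)))
        - p/3 * (p * Real.log p)^2
        + (p/4 * (p * Real.log p) - p^2/8 - ((p * Real.log p) - p)/6)
        + (-(4-p)/6 * ((1-p) * Real.log (1-p)) - (4*p - p^2/2)/6)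
        - ((1+p)^2/2 * Real.log (1+p) - (1+p)^2/4)/6)) (Icc 0 1) := by
      have gen : ∀ A B C U : ℝ → ℝ, ContinuousOn A (Icc 0 1) → ContinuousOn B (Icc 0 1) →
          ContinuousOn C (Icc 0 1) → ContinuousOn U (Icc 0 1) →
          ContinuousOn (fun p : ℝ => (p/2 * A p - p^2/4 - (1-p)/2 * B p + (1-p)^2/4)
      - ((-(1-p)*(1+2*p)/6) * B p * C p
        + p^2/3 * A p * C p
        - (-(1+2*p)/6) * U p
        - p/3 * (A p)^2
        + (p/4 * A p - p^2/8 - (A p - p)/6)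
        + (-(4-p)/6 * B p - (4*p - p^2/2)/6)
        - ((1+p)^2/2 * C p - (1+p)^2/4)/6)) (Icc 0 1) := by
        intro A B C U h1 h2 h3 h4
        simp only [div_eq_mul_inv]
        fun_prop
      exact gen _ _ _ _ ha' hb' hl' hG
    refine this.congr ?_
    intro p _
    simp only
    ring
  · intro p hp
    have h0 : p ≠ 0 := hp.1.ne'
    have h1 : 1 - p ≠ 0 := by linarith [hp.2]
    have h2 : 1 + p ≠ 0 := by linarith [hp.1]
    have dp := hasDerivAt_id' p
    have da := Real.hasDerivAt_log h0
    have db := (dp.const_sub 1).log h1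
    have dc := (dp.const_add 1).log h2
    have dq := dp.const_sub 1
    have dr := dp.const_add 1
    have dG := (((dq.pow 2).neg.mul ((dp.const_mul 2).const_add 1)).div_const 6)
    have D := (((((dp.pow 2).div_const 2).mul da).sub ((dp.pow 2).div_const 4)).sub
        (((dq.pow 2).div_const 2).mul db)).add ((dq.pow 2).div_const 4)
    have E := (((((((dG.mul db).mul dc).add ((((dp.pow 3).div_const 3).mul da).mul dc)).sub
      (dG.mul (da.mul db))).sub (((dp.pow 3).div_const 3).mul (da.pow 2))).add
      (((((dp.pow 2).div_const 4).mul da).sub ((dp.pow 2).div_const 8)).sub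
        (((dp.mul da).sub dp).div_const 6))).add
      ((((dq.mul (dp.const_sub 4)).neg.div_const 6).mul db).sub
        (((dp.const_mul 4).sub ((dp.pow 2).div_const 2)).div_const 6))).sub
      (((((dr.pow 2).div_const 2).mul dc).sub ((dr.pow 2).div_const 4)).div_const 6)
    refine (D.sub E).congr_deriv ?_
    simp
    generalize Real.log p = a
    generalize Real.log (1-p) = b
    generalize Real.log (1+p) = c
    field_simp
    ring
  · exact hiw.add hi

lemma mk_inner (p : ℝ) (hp : 0 < p) :
    ∫ q in (0:ℝ)..1, q / (p+q) = 1 - p * (Real.log (1+p) - Real.log p) := by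
  have h := intervalIntegral.integral_eq_sub_of_hasDerivAt (a := 0) (b := 1)
    (f := fun q : ℝ => q - p * Real.log (p+q))
    (f' := fun q => q/(p+q)) ?_ ?_
  · rw [h]; simp [add_comm]; ring
  · intro x hx
    rw [uIcc_of_le zero_le_one] at hx
    have h1' : p + x ≠ 0 := by linarith [hx.1]
    have := (hasDerivAt_id' x).sub ((((hasDerivAt_id' x).const_add p).log h1').const_mul p)
    refine this.congr_deriv ?_
    field_simp
    ring
  · apply ContinuousOn.intervalIntegrable
    apply ContinuousOn.div (by fun_prop) (by fun_prop)
    intro x hx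
    rw [uIcc_of_le zero_le_one] at hx
    linarith [hx.1]

theorem integral_markov_entropy_term :
    (∫ p in (0:ℝ)..1, ∫ q in (0:ℝ)..1,
        ((1 - p) * q * Real.log (1 - p) + p * q * Real.log p +
          p * q * Real.log q + p * (1 - q) * Real.log (1 - q)) / (p + q)) =
      (2 / 3) * Real.log 2 + (2 / 3) * (Real.log 2) ^ 2 - π ^ 2 / 9 - 1 / 6 := by
  set h : ℝ → ℝ := fun p => p * Real.log p + (1-p) * Real.log (1-p) with hh
  set μ : Measure ℝ := volume.restrict (Ioc (0:ℝ) 1) with hμ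
  have hc : Continuous h := Real.continuous_mul_log.add
    (Real.continuous_mul_log.comp (continuous_const.sub continuous_id))
  obtain ⟨M, hM⟩ := (isCompact_Icc (a := (0:ℝ)) (b := 1)).exists_bound_of_continuousOn hc.continuousOn
  let A : ℝ × ℝ → ℝ := fun z => h z.1 * (z.2 / (z.1 + z.2))
  have hA : Integrable A (μ.prod μ) := by
    apply Integrable.of_bound (C := M)
    · have := hc.measurable
      exact (by fun_prop : Measurable A).aestronglyMeasurable
    · rw [hμ, Measure.prod_restrict]
      filter_upwards [ae_restrict_mem (measurableSet_Ioc.prod measurableSet_Ioc)] with z hz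
      obtain ⟨⟨h1, h2⟩, h3, h4⟩ := hz
      have b1 := hM z.1 ⟨h1.le, h2⟩
      have b2 : ‖z.2 / (z.1 + z.2)‖ ≤ 1 := by
        rw [norm_of_nonneg (by positivity), div_le_one (by positivity)]
        linarith
      calc ‖A z‖ = ‖h z.1‖ * ‖z.2 / (z.1 + z.2)‖ := norm_mul _ _
        _ ≤ M * 1 := mul_le_mul b1 b2 (norm_nonneg _) ((norm_nonneg _).trans b1)
        _ = M := mul_one M
  have hA' : Integrable (fun z : ℝ × ℝ => A (z.2, z.1)) (μ.prod μ) := hA.swap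
  have key : ∫ p, ∫ q, A (p, q) ∂μ ∂μ =
      (1 / 3) * Real.log 2 + (1 / 3) * (Real.log 2) ^ 2 - π ^ 2 / 18 - 1 / 12 := by
    rw [← mk_J, intervalIntegral.integral_of_le zero_le_one]
    apply setIntegral_congr_fun measurableSet_Ioc
    intro p hp
    simp only [A]
    rw [integral_const_mul, ← mk_inner p hp.1, intervalIntegral.integral_of_le zero_le_one]
  have key2 : ∫ p, ∫ q, A (q, p) ∂μ ∂μ = ∫ p, ∫ q, A (p, q) ∂μ ∂μ :=
    integral_integral_swap (f := fun p q => A (q, p)) hA'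
  have e : ∀ p q : ℝ, ((1 - p) * q * Real.log (1 - p) + p * q * Real.log p +
          p * q * Real.log q + p * (1 - q) * Real.log (1 - q)) / (p + q) = A (p, q) + A (q, p) := by
    intro p q
    simp only [A, hh, add_comm q p]
    ring
  simp only [intervalIntegral.integral_of_le zero_le_one, e]
  have := integral_integral_add (f := fun z => A z) hA hA'
  rw [← hμ]
  simp only at this
  rw [this, key2, key]
  ring
end

section
/- The double integral satisfies −2 ∫_0^1 ∫_0^1 (q/(p+q)) ln(q/(p+q)) dp dq = 2 ln 2 − π²/12; equivalently, ∫_0^1 ∫_0^1 (q/(p+q)) ln(q/(p+q)) dp dq = π²/24 − ln 2. -/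
open Real

open MeasureTheory Set

lemma aux_int_pow_log (n : ℕ) :
    IntervalIntegrable (fun s : ℝ => s ^ n * Real.log s) volume 0 1 :=
  (intervalIntegral.intervalIntegrable_log').continuousOn_mul (by fun_prop)

lemma aux_pow_log (n : ℕ) :
    ∫ s in (0:ℝ)..1, s ^ n * Real.log s = -(1 / ((n:ℝ) + 1) ^ 2) := by
  have hn : ((n:ℝ) + 1) ≠ 0 := by positivity
  have h := intervalIntegral.integral_eq_sub_of_hasDerivAt_of_le (a := 0) (b := 1)
    (f := fun s : ℝ => s ^ n * (s * Real.log s) / (n + 1) - s ^ (n + 1) / ((n:ℝ) + 1) ^ 2)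
    (f' := fun s : ℝ => s ^ n * Real.log s) zero_le_one
    (by
      have := Real.continuous_mul_log
      apply Continuous.continuousOn
      fun_prop)
    (by
      intro s hs
      have hs0 : s ≠ 0 := hs.1.ne'
      have h1 := ((hasDerivAt_pow (n + 1) s).mul (Real.hasDerivAt_log hs0)).div_const ((n:ℝ) + 1)
      have h2 := (hasDerivAt_pow (n + 1) s).div_const (((n:ℝ) + 1) ^ 2)
      have h3 := h1.sub h2
      refine (h3.congr_of_eventuallyEq (Filter.Eventually.of_forall fun t => ?_)).congr_deriv ?_
      · simp [pow_succ]; ring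
      · simp only [Nat.add_sub_cancel, pow_succ]; push_cast; field_simp; ring)
    (aux_int_pow_log n)
  rw [h]; simp

lemma aux_alt : HasSum (fun n : ℕ => (-1:ℝ) ^ n * (-(1 / ((n:ℝ) + 1) ^ 2))) (-(π ^ 2 / 12)) := by
  have hz := hasSum_zeta_two
  have he : HasSum (fun n : ℕ => if Even n then 2 * ((1:ℝ) / (n:ℝ) ^ 2) else 0) (π ^ 2 / 12) := by
    have hinj : Function.Injective (fun n : ℕ => 2 * n) := fun a b h => by
      simpa using h
    refine (hinj.hasSum_iff ?_).1 ?_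
    · intro x hx
      rw [if_neg]
      rintro ⟨r, hr⟩
      exact hx ⟨r, by simp; omega⟩
    · have := hz.mul_left (1/2)
      convert! this using 1
      · funext n
        simp
        ring
      · ring
  have hs := he.sub hz
  have h0 := (hasSum_nat_add_iff' 1).2 hs
  convert! h0 using 1
  · funext n
    push_cast
    rcases Nat.even_or_odd n with h | h
    · rw [if_neg (by simpa [Nat.even_add_one] using h), h.neg_one_pow]; ring
    · rw [if_pos (by simpa [Nat.even_add_one] using h), h.neg_one_pow]; ring
  · simp; ring

lemma aux_log_div : ∫ s in (0:ℝ)..1, Real.log s / (1 + s) = -(π ^ 2 / 12) := by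
  have key := hasSum_integral_of_summable_integral_norm (μ := volume.restrict (Ioc (0:ℝ) 1))
    (F := fun (n : ℕ) (s : ℝ) => (-1:ℝ) ^ n * (s ^ n * Real.log s)) (by
      intro n
      exact ((intervalIntegrable_iff_integrableOn_Ioc_of_le zero_le_one).1
        (aux_int_pow_log n)).const_mul _) (by
      have : ∀ n : ℕ, ∫ s in Ioc (0:ℝ) 1, ‖(-1:ℝ) ^ n * (s ^ n * Real.log s)‖
          = 1 / ((n:ℝ) + 1) ^ 2 := by
        intro n
        have e : ∫ s in Ioc (0:ℝ) 1, ‖(-1:ℝ) ^ n * (s ^ n * Real.log s)‖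
          = ∫ s in Ioc (0:ℝ) 1, -(s ^ n * Real.log s) := by
          apply setIntegral_congr_fun measurableSet_Ioc
          intro s hs
          have h1 : Real.log s ≤ 0 := Real.log_nonpos hs.1.le hs.2
          have h2 : 0 ≤ s ^ n := pow_nonneg hs.1.le _
          simp only [norm_mul, norm_pow, norm_neg, norm_one, one_pow, one_mul]
          rw [← norm_pow, Real.norm_of_nonneg h2, Real.norm_of_nonpos h1]
          ring
        rw [e, integral_neg, ← intervalIntegral.integral_of_le zero_le_one, aux_pow_log, neg_neg]
      simp_rw [this]
      have := (summable_nat_add_iff 1).2 hasSum_zeta_two.summable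
      simpa using this)
  have e1 : ∀ n : ℕ, ∫ s in Ioc (0:ℝ) 1, (-1:ℝ) ^ n * (s ^ n * Real.log s)
      = (-1:ℝ) ^ n * (-(1 / ((n:ℝ) + 1) ^ 2)) := by
    intro n
    rw [integral_const_mul, ← intervalIntegral.integral_of_le zero_le_one, aux_pow_log]
  simp_rw [e1] at key
  rw [← key.unique aux_alt, intervalIntegral.integral_of_le zero_le_one,
    integral_Ioc_eq_integral_Ioo, integral_Ioc_eq_integral_Ioo]
  apply setIntegral_congr_fun measurableSet_Ioo
  intro s hs
  have : HasSum (fun n : ℕ => (-s) ^ n) (1 - (-s))⁻¹ :=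
    hasSum_geometric_of_abs_lt_one (by rw [abs_neg, abs_of_pos hs.1]; exact hs.2)
  have h2 := (this.mul_right (Real.log s)).tsum_eq
  simp only
  rw [div_eq_inv_mul, ← sub_neg_eq_add, ← h2]
  congr 1
  funext n
  rw [neg_pow]; ring

/-- the one-variable profile -/
noncomputable def auxH (s : ℝ) : ℝ := (s / (1 + |s|)) * Real.log (s / (1 + |s|))

lemma auxH_cont : Continuous auxH := by
  have h : Continuous (fun s : ℝ => s / (1 + |s|)) :=
    continuous_id.div (by fun_prop) (fun s => by positivity)
  exact Real.continuous_mul_log.comp h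

lemma auxH_bound {s : ℝ} (hs : 0 ≤ s) : ‖auxH s‖ ≤ 1 := by
  rcases hs.eq_or_lt with rfl | h
  · simp [auxH]
  · have := Real.abs_log_mul_self_lt (s / (1 + |s|)) (by positivity)
      (by rw [abs_of_pos h, div_le_one (by positivity)]; linarith)
    rw [auxH, mul_comm]
    exact this.le

noncomputable def auxG (x : ℝ) : ℝ := ∫ s in (0:ℝ)..x, auxH s

lemma auxG_deriv (x : ℝ) : HasDerivAt auxG (auxH x) x :=
  intervalIntegral.integral_hasDerivAt_right (auxH_cont.intervalIntegrable _ _)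
    (auxH_cont.stronglyMeasurableAtFilter _ _) auxH_cont.continuousAt

lemma auxG_cont : Continuous auxG :=
  continuous_iff_continuousAt.2 fun x => (auxG_deriv x).continuousAt

lemma auxG_bound {x : ℝ} (hx : 0 ≤ x) : ‖auxG x‖ ≤ x := by
  have := intervalIntegral.norm_integral_le_of_norm_le_const (a := 0) (b := x) (C := 1)
    (f := auxH) (fun s hs => by
      rw [uIoc_of_le hx] at hs
      exact auxH_bound hs.1.le)
  simpa [auxG, abs_of_nonneg hx] using this

lemma aux_pG_bound {p : ℝ} (hp : 0 ≤ p) : ‖p * auxG p⁻¹‖ ≤ 1 := by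
  rcases hp.eq_or_lt with rfl | h
  · simp
  · rw [norm_mul, Real.norm_of_nonneg hp]
    calc p * ‖auxG p⁻¹‖ ≤ p * p⁻¹ := by
          gcongr; exact auxG_bound (by positivity)
      _ = 1 := mul_inv_cancel₀ h.ne'

lemma aux_inner {p : ℝ} (hp : 0 < p) :
    ∫ q in (0:ℝ)..1, (q / (p + q)) * Real.log (q / (p + q)) = p * auxG p⁻¹ := by
  have h : ∫ q in (0:ℝ)..1, (q / (p + q)) * Real.log (q / (p + q))
      = ∫ q in (0:ℝ)..1, auxH (q / p) := by
    apply intervalIntegral.integral_congr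
    intro q hq
    rw [uIcc_of_le zero_le_one] at hq
    have : q / p / (1 + |q / p|) = q / (p + q) := by
      have := hq.1
      rw [abs_of_nonneg (by positivity)]
      field_simp
    simp only [auxH, this]
  rw [h, intervalIntegral.integral_comp_div _ hp.ne']
  simp [auxG]

/-- the reflected profile -/
noncomputable def auxK (p : ℝ) : ℝ := -(Real.log (1 + p) / (1 + p))

lemma auxH_inv {p : ℝ} (hp : 0 < p) : auxH p⁻¹ = auxK p := by
  have : p⁻¹ / (1 + |p⁻¹|) = (1 + p)⁻¹ := by
    rw [abs_of_pos (by positivity)]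
    field_simp
    ring
  rw [auxH, auxK, this, Real.log_inv]
  ring

lemma auxK_int : IntervalIntegrable auxK volume 0 1 := by
  apply ContinuousOn.intervalIntegrable
  rw [uIcc_of_le zero_le_one]
  intro p hp
  have : 1 + p ≠ 0 := by linarith [hp.1]
  unfold auxK
  apply ContinuousAt.continuousWithinAt
  fun_prop (disch := assumption)

lemma aux_pG_int : IntervalIntegrable (fun p : ℝ => p * auxG p⁻¹) volume 0 1 := by
  rw [intervalIntegrable_iff_integrableOn_Ioc_of_le zero_le_one]
  refine Measure.integrableOn_of_bounded (M := 1) (by simp) ?_ ?_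
  · exact (measurable_id.mul (auxG_cont.measurable.comp measurable_inv)).aestronglyMeasurable
  · filter_upwards [ae_restrict_mem measurableSet_Ioc] with p hp
    exact aux_pG_bound hp.1.le

lemma aux_parts : ∫ p in (0:ℝ)..1, p * auxG p⁻¹
    = (1/2) * ((∫ s in (0:ℝ)..1, auxH s) + ∫ s in (0:ℝ)..1, auxK s) := by
  have h := intervalIntegral.integral_eq_sub_of_hasDerivAt_of_le (a := 0) (b := 1)
    (f := fun p : ℝ => p / 2 * (p * auxG p⁻¹))
    (f' := fun p : ℝ => p * auxG p⁻¹ - (1/2) * auxK p) zero_le_one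
    (by
      intro p hp
      rcases hp.1.eq_or_lt with rfl | h
      · have h0 : Filter.Tendsto (fun p : ℝ => p / 2) (nhdsWithin 0 (Icc 0 1)) (nhds 0) := by
          have : Continuous (fun p : ℝ => p / 2) := by fun_prop
          simpa using (this.tendsto 0).mono_left nhdsWithin_le_nhds
        have h1 := h0.zero_mul_isBoundedUnder_le (g := fun p : ℝ => p * auxG p⁻¹)
          (Filter.isBoundedUnder_of_eventually_le (a := 1) (by
            filter_upwards [self_mem_nhdsWithin] with p hp
            exact aux_pG_bound hp.1))
        simpa [ContinuousWithinAt] using h1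
      · apply ContinuousAt.continuousWithinAt
        have := h.ne'
        have hG := auxG_cont
        have h2 : ContinuousAt (fun p : ℝ => auxG p⁻¹) p :=
          hG.continuousAt.comp (continuousAt_inv₀ this)
        fun_prop)
    (by
      intro p hp
      have hp0 : p ≠ 0 := hp.1.ne'
      have h1 := (auxG_deriv p⁻¹).comp p (hasDerivAt_inv hp0)
      have h2 := ((hasDerivAt_id p).div_const 2).mul ((hasDerivAt_id p).mul h1)
      refine h2.congr_deriv ?_
      rw [auxH_inv hp.1]
      simp
      field_simp
      ring)
    (aux_pG_int.sub (auxK_int.const_mul _))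
  rw [intervalIntegral.integral_sub aux_pG_int (auxK_int.const_mul _),
    intervalIntegral.integral_const_mul] at h
  simp only [auxG, inv_one] at h ⊢
  linarith

lemma aux_sum : (∫ s in (0:ℝ)..1, auxH s) + ∫ s in (0:ℝ)..1, auxK s
    = π ^ 2 / 12 - 2 * Real.log 2 := by
  have hl : IntervalIntegrable Real.log volume 0 1 := intervalIntegral.intervalIntegrable_log'
  have hd : IntervalIntegrable (fun s : ℝ => Real.log s / (1 + s)) volume 0 1 := by
    simp_rw [div_eq_mul_inv]
    apply hl.mul_continuousOn
    rw [uIcc_of_le zero_le_one]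
    intro p hp
    have : 1 + p ≠ 0 := by linarith [hp.1]
    apply ContinuousAt.continuousWithinAt
    fun_prop (disch := assumption)
  have hp : IntervalIntegrable (fun s : ℝ => Real.log (1 + s)) volume 0 1 := by
    apply ContinuousOn.intervalIntegrable
    rw [uIcc_of_le zero_le_one]
    intro p hp
    have : 1 + p ≠ 0 := by linarith [hp.1]
    apply ContinuousAt.continuousWithinAt
    fun_prop (disch := assumption)
  rw [← intervalIntegral.integral_add (auxH_cont.intervalIntegrable _ _) auxK_int]
  have e : ∫ s in (0:ℝ)..1, (auxH s + auxK s)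
      = ∫ s in (0:ℝ)..1, ((Real.log s - Real.log s / (1 + s)) - Real.log (1 + s)) := by
    rw [intervalIntegral.integral_of_le zero_le_one, intervalIntegral.integral_of_le zero_le_one]
    apply setIntegral_congr_fun measurableSet_Ioc
    intro s hs
    have h0 := hs.1
    have h1 : 1 + s ≠ 0 := by positivity
    simp only [auxH, auxK, abs_of_pos h0]
    rw [Real.log_div h0.ne' h1]
    field_simp
    ring
  rw [e, intervalIntegral.integral_sub (hl.sub hd) hp, intervalIntegral.integral_sub hl hd,
    aux_log_div, intervalIntegral.integral_comp_add_left (fun x => Real.log x), integral_log,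
    integral_log]
  norm_num
  ring

lemma aux_main : (∫ p in (0:ℝ)..1, ∫ q in (0:ℝ)..1,
        (q / (p + q)) * Real.log (q / (p + q))) =
      π ^ 2 / 24 - Real.log 2 := by
  have : (∫ p in (0:ℝ)..1, ∫ q in (0:ℝ)..1, (q / (p + q)) * Real.log (q / (p + q)))
      = ∫ p in (0:ℝ)..1, p * auxG p⁻¹ := by
    rw [intervalIntegral.integral_of_le zero_le_one, intervalIntegral.integral_of_le zero_le_one]
    apply setIntegral_congr_fun measurableSet_Ioc
    intro p hp
    exact aux_inner hp.1
  rw [this, aux_parts, aux_sum]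
  ring

theorem integral_stationary_entropy_term :
    (-2 * ∫ p in (0:ℝ)..1, ∫ q in (0:ℝ)..1,
        (q / (p + q)) * Real.log (q / (p + q))) =
      2 * Real.log 2 - π ^ 2 / 12 ∧
    (∫ p in (0:ℝ)..1, ∫ q in (0:ℝ)..1,
        (q / (p + q)) * Real.log (q / (p + q))) =
      π ^ 2 / 24 - Real.log 2 := by
  refine ⟨?_, aux_main⟩
  rw [aux_main]
  ring
end
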